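/- Let X ⊂ ℝ^d be finite, X_m ⊆ X, and S, T ⊆ X_m. Suppose that when running SingleLinkage on X_m, T is merged into a single cluster strictly before S is (i.e., g_m(S) > g_m(T)). Then there exists a pair of points u, v ∈ S such that d_MM(u,v;X_m) − d_MM(u,v;X) ≥ d_{g(T)} − d_{g(S)}, where d_{g(T)} and d_{g(S)} are the merge distances of T and S in the run of SingleLinkage on the full set X. -/

import Mathlib

open scoped Classical
open Real

noncomputable section

variable {P : Type*} [MetricSpace P]

/-- The maximum distance between consecutive points of a list (`0` for lists of length `≤ 1`). -/
def pathCost (p : List P) : ℝ := ((p.zip p.tail).map fun q => dist q.1 q.2).foldr max 0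

/-- Min-max (bottleneck) distance between `x` and `y` within the finite set `X`. -/
def minMaxD (X : Finset P) (x y : P) : ℝ :=
  sInf { r | ∃ p : List P, p ≠ [] ∧ p.Nodup ∧ (∀ a ∈ p, a ∈ X) ∧
    p.head? = some x ∧ p.getLast? = some y ∧ r = pathCost p }

/-- One merge step of single linkage at distance threshold `D`. -/
def SLStep (X : Finset P) (D : ℝ) (a b : P) : Prop := a ∈ X ∧ b ∈ X ∧ dist a b ≤ D

/-- Two points lie in a common single-linkage cluster at distance threshold `D`. -/
def SLLinked (X : Finset P) (D : ℝ) : P → P → Prop := Relation.ReflTransGen (SLStep X D)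

/-- The merge distance at iteration `i` of single linkage on `X`. -/
def mergeDist (X : Finset P) : ℕ → ℝ
  | 0 => 0
  | (i+1) => sInf { r | ∃ x ∈ X, ∃ y ∈ X, ¬ SLLinked X (mergeDist X i) x y ∧ r = dist x y }

/-- `g(S)`: the first iteration of single linkage on `X` after which all points of `S`
lie in a single cluster. -/
def mergeIdx (X : Finset P) (S : Set P) : ℕ :=
  sInf { ℓ : ℕ | ∀ x ∈ S, ∀ y ∈ S, SLLinked X (mergeDist X ℓ) x y }

theorem pathCost_cons_cons (a b : P) (l : List P) :
    pathCost (a :: b :: l) = max (dist a b) (pathCost (b :: l)) := rfl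

theorem pathCost_nonneg (p : List P) : 0 ≤ pathCost p := by
  match p with
  | [] => exact le_refl _
  | [a] => exact le_refl _
  | a :: b :: l => exact le_max_of_le_left dist_nonneg

theorem pathCost_le_iff {D : ℝ} (hD : 0 ≤ D) (p : List P) :
    pathCost p ≤ D ↔ p.IsChain (fun a b => dist a b ≤ D) := by
  match p with
  | [] => simpa [pathCost] using hD
  | [a] => simpa [pathCost] using hD
  | a :: b :: l =>
    rw [pathCost_cons_cons, max_le_iff, pathCost_le_iff hD (b :: l), List.isChain_cons_cons]

theorem mergeDist_nonneg (X : Finset P) (i : ℕ) : 0 ≤ mergeDist X i := by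
  cases i with
  | zero => exact le_refl _
  | succ i =>
    refine Real.sInf_nonneg ?_
    rintro r ⟨x, -, y, -, -, rfl⟩
    exact dist_nonneg

theorem mergeDist_succ_le {X : Finset P} {i : ℕ} {x y : P} (hx : x ∈ X) (hy : y ∈ X)
    (h : ¬ SLLinked X (mergeDist X i) x y) : mergeDist X (i + 1) ≤ dist x y := by
  refine csInf_le ⟨0, ?_⟩ ⟨x, hx, y, hy, h, rfl⟩
  rintro r ⟨x, -, y, -, -, rfl⟩
  exact dist_nonneg

/-- As long as some pair of points is not linked, the next merge distance is attained by a pair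
of points in different clusters. -/
theorem exists_dist_eq_mergeDist_succ {X : Finset P} {i : ℕ} {x y : P} (hx : x ∈ X) (hy : y ∈ X)
    (h : ¬ SLLinked X (mergeDist X i) x y) :
    ∃ a ∈ X, ∃ b ∈ X, ¬ SLLinked X (mergeDist X i) a b ∧ mergeDist X (i + 1) = dist a b := by
  have hfin : { r | ∃ x ∈ X, ∃ y ∈ X, ¬ SLLinked X (mergeDist X i) x y ∧ r = dist x y }.Finite := by
    refine ((X ×ˢ X).finite_toSet.image fun q => dist q.1 q.2).subset ?_
    rintro r ⟨a, ha, b, hb, -, rfl⟩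
    exact ⟨(a, b), by simp [ha, hb], rfl⟩
  have hne : { r | ∃ x ∈ X, ∃ y ∈ X, ¬ SLLinked X (mergeDist X i) x y ∧ r = dist x y }.Nonempty :=
    ⟨_, x, hx, y, hy, h, rfl⟩
  exact hne.csInf_mem hfin

/-- Single linkage on a finite set eventually produces a single cluster. -/
theorem exists_forall_linked (X : Finset P) :
    ∃ i, ∀ x ∈ X, ∀ y ∈ X, SLLinked X (mergeDist X i) x y := by
  by_contra! hcon
  have key : ∀ i, ∃ a ∈ X, ∃ b ∈ X,
      ¬ SLLinked X (mergeDist X i) a b ∧ mergeDist X (i + 1) = dist a b := by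
    intro i
    obtain ⟨x, hx, y, hy, h⟩ := hcon i
    exact exists_dist_eq_mergeDist_succ hx hy h
  have hmono : StrictMono (mergeDist X) := by
    refine strictMono_nat_of_lt_succ fun i => ?_
    obtain ⟨a, ha, b, hb, hab, h⟩ := key i
    rw [h]
    by_contra! hle
    exact hab (.single ⟨ha, hb, hle⟩)
  have hfin := (X ×ˢ X).finite_toSet.image fun q => dist q.1 q.2
  refine Set.infinite_of_injective_forall_mem (f := fun i => mergeDist X (i + 1))
    (fun i j hij => Nat.succ_injective (hmono.injective hij)) (fun i => ?_) hfin
  obtain ⟨a, ha, b, hb, -, h⟩ := key i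
  exact ⟨(a, b), by simp [ha, hb], h.symm⟩

theorem linked_mergeIdx {X : Finset P} {S : Set P} (hS : S ⊆ ↑X) {x y : P} (hx : x ∈ S)
    (hy : y ∈ S) : SLLinked X (mergeDist X (mergeIdx X S)) x y := by
  obtain ⟨i, hi⟩ := exists_forall_linked X
  have hne : { ℓ : ℕ | ∀ x ∈ S, ∀ y ∈ S, SLLinked X (mergeDist X ℓ) x y }.Nonempty :=
    ⟨i, fun x hx y hy => hi x (hS hx) y (hS hy)⟩
  exact Nat.sInf_mem hne x hx y hy

theorem exists_not_linked_of_lt_mergeIdx {X : Finset P} {S : Set P} {i : ℕ}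
    (h : i < mergeIdx X S) : ∃ x ∈ S, ∃ y ∈ S, ¬ SLLinked X (mergeDist X i) x y := by
  simpa using Nat.notMem_of_lt_sInf h

/-- The merge distance of `T` is at most any threshold at which `T` is linked. -/
theorem mergeDist_mergeIdx_le {X : Finset P} {T : Set P} {D : ℝ} (hD : 0 ≤ D)
    (h : ∀ x ∈ T, ∀ y ∈ T, SLLinked X D x y) : mergeDist X (mergeIdx X T) ≤ D := by
  rcases hg : mergeIdx X T with _ | n
  · exact hD
  · obtain ⟨x, hx, y, hy, hxy⟩ := exists_not_linked_of_lt_mergeIdx (i := n) (X := X) (S := T) (by omega)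
    by_contra! hlt
    refine hxy (Relation.reflTransGen_closed (fun a b hab => ?_) _ _ (h x hx y hy))
    by_contra hn
    exact absurd (mergeDist_succ_le hab.1 hab.2.1 hn) (not_le.2 (hab.2.2.trans_lt hlt))

theorem SLLinked.mono {X Y : Finset P} (h : X ⊆ Y) {D : ℝ} {x y : P} (hxy : SLLinked X D x y) :
    SLLinked Y D x y :=
  Relation.ReflTransGen.mono (fun _ _ hab => ⟨h hab.1, h hab.2.1, hab.2.2⟩) _ _ hxy

theorem linked_of_isChain {X : Finset P} {D : ℝ} {y : P} (p : List P) (x : P)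
    (hX : ∀ a ∈ x :: p, a ∈ X) (hlast : (x :: p).getLast? = some y)
    (hp : (x :: p).IsChain fun a b => dist a b ≤ D) : SLLinked X D x y := by
  induction p generalizing x with
  | nil =>
    obtain rfl : x = y := by simpa using hlast
    exact .refl
  | cons b l ih =>
    rw [List.isChain_cons_cons] at hp
    exact .head ⟨hX x (by simp), hX b (by simp), hp.1⟩
      (ih b (fun a ha => hX a (List.mem_cons_of_mem _ ha)) (by simpa using hlast) hp.2)

theorem exists_nodup_chain_of_linked {X : Finset P} {D : ℝ} {x y : P} (hy : y ∈ X)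
    (h : SLLinked X D x y) : ∃ l : List P, (x :: l).Nodup ∧ (∀ a ∈ x :: l, a ∈ X) ∧
      (x :: l).getLast? = some y ∧ (x :: l).IsChain fun a b => dist a b ≤ D := by
  induction h using Relation.ReflTransGen.head_induction_on with
  | refl => exact ⟨[], by simp [hy]⟩
  | @head a b hab _ ih =>
    obtain ⟨l, hnd, hX, hlast, hc⟩ := ih
    by_cases ha : a ∈ b :: l
    · obtain ⟨s, t, hst⟩ := List.append_of_mem ha
      rw [hst] at hnd hX hlast hc
      refine ⟨t, hnd.of_append_right, fun c hc => hX c (List.mem_append_right _ hc), ?_,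
        hc.right_of_append⟩
      simpa [List.getLast?_append] using hlast
    · refine ⟨b :: l, List.nodup_cons.2 ⟨ha, hnd⟩, ?_, by simpa using hlast,
        List.isChain_cons_cons.2 ⟨hab.2.2, hc⟩⟩
      exact List.forall_mem_cons.2 ⟨hab.1, hX⟩

theorem minMaxD_le_of_linked {X : Finset P} {D : ℝ} (hD : 0 ≤ D) {x y : P} (hy : y ∈ X)
    (h : SLLinked X D x y) : minMaxD X x y ≤ D := by
  obtain ⟨l, hnd, hX, hlast, hc⟩ := exists_nodup_chain_of_linked hy h
  refine le_trans (b := pathCost (x :: l))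
    (csInf_le ⟨0, ?_⟩ ⟨x :: l, by simp, hnd, hX, rfl, hlast, rfl⟩) ((pathCost_le_iff hD _).2 hc)
  rintro r ⟨p, -, -, -, -, -, rfl⟩
  exact pathCost_nonneg p

theorem le_minMaxD_of_not_linked {X : Finset P} {D : ℝ} (hD : 0 ≤ D) {x y : P} (hx : x ∈ X)
    (hy : y ∈ X) (h : ¬ SLLinked X D x y) : D ≤ minMaxD X x y := by
  have hne : x ≠ y := fun hxy => h (hxy ▸ .refl)
  refine le_csInf ⟨_, [x, y], by simp, by simp [hne], by simp [hx, hy], rfl, rfl, rfl⟩ ?_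
  rintro r ⟨p, hp, -, hX, hhead, hlast, rfl⟩
  by_contra! hlt
  rcases p with _ | ⟨a, l⟩
  · exact hp rfl
  · obtain rfl : a = x := by simpa using hhead
    exact h (linked_of_isChain l a hX hlast ((pathCost_le_iff hD _).1 hlt.le))

/-- If, when running SingleLinkage on `X_m ⊆ X`, the set `T` is merged into a
single cluster strictly before `S` (`g_m(S) > g_m(T)`), then there are `u, v ∈ S` with
`d_MM(u,v;X_m) − d_MM(u,v;X) ≥ d_{g(T)} − d_{g(S)}`, where `d_{g(T)}`, `d_{g(S)}` are the merge
distances of `T` and `S` in the run of SingleLinkage on the full set `X`. -/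
theorem stmt7 {d : ℕ} (X Xm : Finset (EuclideanSpace ℝ (Fin d))) (hXm : Xm ⊆ X)
    (S T : Set (EuclideanSpace ℝ (Fin d))) (hS : S ⊆ ↑Xm) (hT : T ⊆ ↑Xm)
    (hmerge : mergeIdx Xm T < mergeIdx Xm S) :
    ∃ u ∈ S, ∃ v ∈ S,
      mergeDist X (mergeIdx X T) - mergeDist X (mergeIdx X S) ≤
        minMaxD Xm u v - minMaxD X u v := by
  obtain ⟨u, hu, v, hv, huv⟩ := exists_not_linked_of_lt_mergeIdx hmerge
  refine ⟨u, hu, v, hv, sub_le_sub ?_ ?_⟩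
  · exact (mergeDist_mergeIdx_le (mergeDist_nonneg _ _)
      fun x hx y hy => (linked_mergeIdx hT hx hy).mono hXm).trans
      (le_minMaxD_of_not_linked (mergeDist_nonneg _ _) (hS hu) (hS hv) huv)
  · exact minMaxD_le_of_linked (mergeDist_nonneg _ _) (hXm (hS hv))
      (linked_mergeIdx (hS.trans (Finset.coe_subset.2 hXm)) hu hv)
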